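/- arXiv:1507.04984 — 6 statements merged into one kernel-verified Lean document; each statement's English description precedes it below -/
import Mathlib

section
/- Let k be a real number with 0 < k < 1, let x be a real number with 0 ≤ x ≤ 1, and let ζ ≥ 0 be a real number satisfying ζ²/2 = (1/k) · ln( (1 + k) / ( √(1 − k²x²) + k·√(1 − x²) ) ). Then x² = sinh(kζ²)/k − (1 + 1/k²) · sinh(kζ²/2)². -/
/-- Inversion of the Liouville relation: if
`ζ²/2 = (1/k) ln((1+k)/(√(1-k²x²)+k√(1-x²)))` then
`x² = sinh(kζ²)/k - (1 + 1/k²) sinh²(kζ²/2)`. -/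
theorem stmt4 (k x ζ : ℝ) (hk : 0 < k) (hk1 : k < 1) (hx0 : 0 ≤ x) (hx1 : x ≤ 1)
    (hζ : 0 ≤ ζ)
    (h : ζ ^ 2 / 2 =
      (1 / k) *
        Real.log ((1 + k) / (Real.sqrt (1 - k ^ 2 * x ^ 2) + k * Real.sqrt (1 - x ^ 2)))) :
    x ^ 2 = Real.sinh (k * ζ ^ 2) / k - (1 + 1 / k ^ 2) * Real.sinh (k * ζ ^ 2 / 2) ^ 2 := by
  have hkx : k ^ 2 * x ^ 2 < 1 := by
    have hx2 : x ^ 2 ≤ 1 := by nlinarith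
    have hk2 : k ^ 2 < 1 := by nlinarith
    nlinarith [sq_nonneg k]
  have ha : 0 < Real.sqrt (1 - k ^ 2 * x ^ 2) := Real.sqrt_pos.mpr (by linarith)
  have hb : 0 ≤ Real.sqrt (1 - x ^ 2) := Real.sqrt_nonneg _
  have ha2 : Real.sqrt (1 - k ^ 2 * x ^ 2) ^ 2 = 1 - k ^ 2 * x ^ 2 :=
    Real.sq_sqrt (by linarith)
  have hb2 : Real.sqrt (1 - x ^ 2) ^ 2 = 1 - x ^ 2 := Real.sq_sqrt (by nlinarith)
  set a := Real.sqrt (1 - k ^ 2 * x ^ 2)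
  set b := Real.sqrt (1 - x ^ 2)
  have hD : 0 < a + k * b := by positivity
  have hu : k * ζ ^ 2 / 2 = Real.log ((1 + k) / (a + k * b)) := by
    rw [mul_div_assoc, h]
    field_simp
  have hexp : Real.exp (k * ζ ^ 2 / 2) = (1 + k) / (a + k * b) := by
    rw [hu, Real.exp_log (by positivity)]
  have hk' : 1 - k ≠ 0 := by linarith
  have hk2 : 1 - k ^ 2 ≠ 0 := by nlinarith
  have hexp' : (1 + k) / (a + k * b) = (a - k * b) / (1 - k) := by
    rw [div_eq_div_iff hD.ne' hk']
    linear_combination k ^ 2 * hb2 - ha2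
  have hneg : Real.exp (-(k * ζ ^ 2 / 2)) = (a + k * b) / (1 + k) := by
    rw [Real.exp_neg, hexp, inv_div]
  have hsinh : Real.sinh (k * ζ ^ 2 / 2) = k * (a - b) / (1 - k ^ 2) := by
    rw [Real.sinh_eq, hneg, hexp, hexp']
    have : 1 + k ≠ 0 := by positivity
    field_simp
    ring
  have hcosh : Real.cosh (k * ζ ^ 2 / 2) = (a - k ^ 2 * b) / (1 - k ^ 2) := by
    rw [Real.cosh_eq, hneg, hexp, hexp']
    have : 1 + k ≠ 0 := by positivity
    field_simp
    ring
  rw [show k * ζ ^ 2 = 2 * (k * ζ ^ 2 / 2) by ring, Real.sinh_two_mul,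
    show 2 * (k * ζ ^ 2 / 2) / 2 = k * ζ ^ 2 / 2 by ring, hsinh, hcosh]
  field_simp
  linear_combination (1 - k ^ 2) * (hb2 - ha2)
end

section
/- Fix a real number k with 0 < k < 1, and for s ∈ (0,1) define F(s) = (2/π) · ∫_{−s}^{s} √( (s² − t²) / ((1 − t²)(1 − k²t²)) ) dt. Then, as s → 0⁺, F(s) = s² + ((1 + k²)/8)·s⁴ + ((3 + 2k² + 3k⁴)/64)·s⁶ + O(s⁸); that is, the function s ↦ F(s) − s² − ((1+k²)/8)s⁴ − ((3+2k²+3k⁴)/64)s⁶ is O(s⁸) as s → 0⁺. -/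
open Asymptotics

/-- The quadratic Taylor polynomial of `((1 - u) (1 - c u))^(-1/2)` at `0` has a cubic error. -/
lemma exists_abs_inv_sqrt_sub_taylor_le (c : ℝ) (hc : 0 < c) (hc1 : c < 1) :
    ∃ C : ℝ, 0 ≤ C ∧ ∀ u : ℝ, 0 ≤ u → u ≤ 1 / 4 →
      |(Real.sqrt ((1 - u) * (1 - c * u)))⁻¹
        - (1 + (1 + c) / 2 * u + (3 + 2 * c + 3 * c ^ 2) / 8 * u ^ 2)| ≤ C * u ^ 3 := by
  obtain ⟨a, ha⟩ : ∃ a, a = (1 + c) / 2 := ⟨_, rfl⟩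
  obtain ⟨b, hb⟩ : ∃ b, b = (3 + 2 * c + 3 * c ^ 2) / 8 := ⟨_, rfl⟩
  rw [← ha, ← hb]
  obtain ⟨r₀, hr₀⟩ : ∃ r, r = 2 * a * b - 2 * a * (a ^ 2 + 2 * b) + 2 * a * c := ⟨_, rfl⟩
  obtain ⟨r₁, hr₁⟩ : ∃ r, r = b ^ 2 - 4 * a ^ 2 * b + c * (a ^ 2 + 2 * b) := ⟨_, rfl⟩
  obtain ⟨r₂, hr₂⟩ : ∃ r, r = -2 * a * b ^ 2 + 2 * a * b * c := ⟨_, rfl⟩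
  obtain ⟨r₃, hr₃⟩ : ∃ r, r = c * b ^ 2 := ⟨_, rfl⟩
  refine ⟨2 * (|r₀| + |r₁| + |r₂| + |r₃|), by positivity, fun u hu hu4 => ?_⟩
  have ha0 : 0 < a := by rw [ha]; positivity
  have hb0 : 0 < b := by rw [hb]; positivity
  obtain ⟨P, hP⟩ : ∃ P, P = 1 + a * u + b * u ^ 2 := ⟨_, rfl⟩
  have hP0 : 0 < P := by rw [hP]; positivity
  rw [← hP]
  have hq : (1 / 2 : ℝ) ^ 2 ≤ (1 - u) * (1 - c * u) := by
    have h : c * u ≤ u := by nlinarith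
    nlinarith
  have hsqrt : 1 / 2 ≤ Real.sqrt ((1 - u) * (1 - c * u)) := Real.le_sqrt_of_sq_le hq
  have hsq : Real.sqrt ((1 - u) * (1 - c * u)) ^ 2 = (1 - u) * (1 - c * u) :=
    Real.sq_sqrt (by nlinarith)
  set w := Real.sqrt ((1 - u) * (1 - c * u))
  have hw0 : 0 < w := by linarith
  have hpoly : P ^ 2 * w ^ 2 - 1 = u ^ 3 * (r₀ + r₁ * u + r₂ * u ^ 2 + r₃ * u ^ 3) := by
    rw [hsq, hP, hr₀, hr₁, hr₂, hr₃, ha, hb]; ring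
  have hR : |r₀ + r₁ * u + r₂ * u ^ 2 + r₃ * u ^ 3| ≤ |r₀| + |r₁| + |r₂| + |r₃| := by
    have hmul : ∀ (r : ℝ) (n : ℕ), |r * u ^ n| ≤ |r| := fun r n => by
      rw [abs_mul, abs_of_nonneg (pow_nonneg hu n)]
      exact mul_le_of_le_one_right (abs_nonneg r) (pow_le_one₀ hu (by linarith))
    have h1 := hmul r₁ 1
    rw [pow_one] at h1
    refine (abs_add_le _ _).trans (add_le_add ((abs_add_le _ _).trans
      (add_le_add ((abs_add_le _ _).trans (add_le_add le_rfl h1)) (hmul r₂ 2))) (hmul r₃ 3))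
  have hfac : w⁻¹ - P = -(P ^ 2 * w ^ 2 - 1) / (w * (1 + P * w)) := by
    have : 0 < 1 + P * w := by positivity
    field_simp
    ring
  have hden : 1 / 2 ≤ w * (1 + P * w) := by
    have : 0 ≤ w * (P * w) := by positivity
    linarith
  rw [hfac, abs_div, abs_neg, hpoly, abs_mul, abs_of_nonneg (pow_nonneg hu 3),
    abs_of_pos (a := w * (1 + P * w)) (by linarith), div_le_iff₀ (by linarith)]
  have hu3 : 0 ≤ u ^ 3 := pow_nonneg hu 3
  have hS : 0 ≤ |r₀| + |r₁| + |r₂| + |r₃| := by positivity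
  calc u ^ 3 * |r₀ + r₁ * u + r₂ * u ^ 2 + r₃ * u ^ 3|
      ≤ u ^ 3 * (|r₀| + |r₁| + |r₂| + |r₃|) := by gcongr
    _ = 2 * (|r₀| + |r₁| + |r₂| + |r₃|) * u ^ 3 * (1 / 2) := by ring
    _ ≤ _ := by gcongr

lemma integral_sqrt_sq_sub_sq {s : ℝ} (hs : 0 < s) :
    ∫ t in (-s)..s, Real.sqrt (s ^ 2 - t ^ 2) = Real.pi / 2 * s ^ 2 := by
  have h := intervalIntegral.smul_integral_comp_mul_left (a := -1) (b := 1)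
    (fun t => Real.sqrt (s ^ 2 - t ^ 2)) s
  have h2 : ∀ x : ℝ, Real.sqrt (s ^ 2 - (s * x) ^ 2) = s * Real.sqrt (1 - x ^ 2) := fun x => by
    rw [show s ^ 2 - (s * x) ^ 2 = s ^ 2 * (1 - x ^ 2) by ring, Real.sqrt_mul (sq_nonneg s),
      Real.sqrt_sq hs.le]
  simp only [h2, intervalIntegral.integral_const_mul, integral_sqrt_one_sub_sq, smul_eq_mul,
    mul_neg, mul_one] at h
  rw [← h]; ring

lemma hasDerivAt_sq_sub_sq_mul_sqrt {s t : ℝ} (h : 0 < s ^ 2 - t ^ 2) :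
    HasDerivAt (fun t => (s ^ 2 - t ^ 2) * Real.sqrt (s ^ 2 - t ^ 2))
      (-3 * t * Real.sqrt (s ^ 2 - t ^ 2)) t := by
  have h1 : HasDerivAt (fun t : ℝ => s ^ 2 - t ^ 2) (-(2 * t)) t := by
    simpa using ((hasDerivAt_id t).pow 2).const_sub (s ^ 2)
  refine (h1.mul (h1.sqrt h.ne')).congr_deriv ?_
  have hw := Real.sq_sqrt h.le
  have hw0 := Real.sqrt_pos.2 h
  set w := Real.sqrt (s ^ 2 - t ^ 2)
  rw [← hw]
  field_simp
  ring

/-- Reduction formula for the moments of the semicircle. -/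
lemma integral_pow_mul_sqrt_sq_sub_sq_recurrence {s : ℝ} (hs : 0 < s) (n : ℕ) :
    (n + 4) * ∫ t in (-s)..s, t ^ (n + 2) * Real.sqrt (s ^ 2 - t ^ 2) =
      (n + 1) * s ^ 2 * ∫ t in (-s)..s, t ^ n * Real.sqrt (s ^ 2 - t ^ 2) := by
  have hint : ∀ m : ℕ, IntervalIntegrable (fun t => t ^ m * Real.sqrt (s ^ 2 - t ^ 2))
      MeasureTheory.volume (-s) s := fun m => Continuous.intervalIntegrable (by fun_prop) _ _
  have hftc := intervalIntegral.integral_eq_sub_of_hasDerivAt_of_le (a := -s) (b := s)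
    (f := fun t => t ^ (n + 1) * ((s ^ 2 - t ^ 2) * Real.sqrt (s ^ 2 - t ^ 2)))
    (f' := fun t => (n + 1) * s ^ 2 * (t ^ n * Real.sqrt (s ^ 2 - t ^ 2))
      - (n + 4) * (t ^ (n + 2) * Real.sqrt (s ^ 2 - t ^ 2)))
    (by linarith) (by fun_prop) (fun t ht => by
      have h : 0 < s ^ 2 - t ^ 2 := by nlinarith [ht.1, ht.2]
      refine ((hasDerivAt_pow (n + 1) t).mul (hasDerivAt_sq_sub_sq_mul_sqrt h)).congr_deriv ?_
      push_cast
      ring)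
    (((hint n).const_mul _).sub ((hint (n + 2)).const_mul _))
  rw [intervalIntegral.integral_sub ((hint n).const_mul _) ((hint (n + 2)).const_mul _),
    intervalIntegral.integral_const_mul, intervalIntegral.integral_const_mul] at hftc
  simp only [neg_sq, sub_self, zero_mul, mul_zero] at hftc
  linarith

lemma integral_sqrt_mul_even_quartic {s : ℝ} (hs : 0 < s) (a b : ℝ) :
    ∫ t in (-s)..s, Real.sqrt (s ^ 2 - t ^ 2) * (1 + a * t ^ 2 + b * (t ^ 2) ^ 2) =
      Real.pi / 2 * (s ^ 2 + a / 4 * s ^ 4 + b / 8 * s ^ 6) := by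
  have hint : ∀ m : ℕ, IntervalIntegrable (fun t => t ^ m * Real.sqrt (s ^ 2 - t ^ 2))
      MeasureTheory.volume (-s) s := fun m => Continuous.intervalIntegrable (by fun_prop) _ _
  have h0 := integral_sqrt_sq_sub_sq hs
  have h2 := integral_pow_mul_sqrt_sq_sub_sq_recurrence hs 0
  have h4 := integral_pow_mul_sqrt_sq_sub_sq_recurrence hs 2
  have hrw : ∀ t : ℝ, Real.sqrt (s ^ 2 - t ^ 2) * (1 + a * t ^ 2 + b * (t ^ 2) ^ 2) =
      t ^ 0 * Real.sqrt (s ^ 2 - t ^ 2) + a * (t ^ 2 * Real.sqrt (s ^ 2 - t ^ 2))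
        + b * (t ^ 4 * Real.sqrt (s ^ 2 - t ^ 2)) := fun t => by ring
  simp only [hrw]
  rw [intervalIntegral.integral_add ((hint 0).add ((hint 2).const_mul a)) ((hint 4).const_mul b),
    intervalIntegral.integral_add (hint 0) ((hint 2).const_mul a),
    intervalIntegral.integral_const_mul, intervalIntegral.integral_const_mul]
  norm_num at h2 h4 ⊢
  rw [h0] at h2 ⊢
  linear_combination (a / 4 + b * s ^ 2 / 8) * h2 + b / 6 * h4

/-- Small-`s` expansion of `F(s) = (2/π)∫_{-s}^{s} √((s²-t²)/((1-t²)(1-k²t²))) dt`: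
`F(s) = s² + ((1+k²)/8)s⁴ + ((3+2k²+3k⁴)/64)s⁶ + O(s⁸)` as `s → 0⁺`. -/
theorem stmt5 (k : ℝ) (hk : 0 < k) (hk1 : k < 1) (F : ℝ → ℝ)
    (hF : ∀ s ∈ Set.Ioo (0:ℝ) 1, F s =
      (2 / Real.pi) *
        ∫ t in (-s)..s, Real.sqrt ((s ^ 2 - t ^ 2) / ((1 - t ^ 2) * (1 - k ^ 2 * t ^ 2)))) :
    (fun s : ℝ => F s - s ^ 2 - ((1 + k ^ 2) / 8) * s ^ 4
        - ((3 + 2 * k ^ 2 + 3 * k ^ 4) / 64) * s ^ 6)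
      =O[nhdsWithin 0 (Set.Ioi 0)] (fun s : ℝ => s ^ 8) := by
  have hc1 : k ^ 2 < 1 := by nlinarith
  obtain ⟨C, hC, hbound⟩ := exists_abs_inv_sqrt_sub_taylor_le (k ^ 2) (by positivity) hc1
  refine IsBigO.of_bound (2 / Real.pi * (2 * C)) ?_
  filter_upwards [Ioo_mem_nhdsGT (show (0 : ℝ) < 1 / 2 by norm_num)] with s hs
  obtain ⟨hs0, hs2⟩ := hs
  have hpi := Real.pi_pos
  have htsq : ∀ t ∈ Set.Icc (-s) s, t ^ 2 ≤ s ^ 2 := fun t ht => by nlinarith [ht.1, ht.2]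
  have hs4 : s ^ 2 ≤ 1 / 4 := by nlinarith
  have hfactor : ∫ t in (-s)..s,
        Real.sqrt ((s ^ 2 - t ^ 2) / ((1 - t ^ 2) * (1 - k ^ 2 * t ^ 2))) =
      ∫ t in (-s)..s, Real.sqrt (s ^ 2 - t ^ 2) *
        (Real.sqrt ((1 - t ^ 2) * (1 - k ^ 2 * t ^ 2)))⁻¹ := by
    refine intervalIntegral.integral_congr fun t ht => ?_
    rw [Set.uIcc_of_le (by linarith)] at ht
    exact (Real.sqrt_div (sub_nonneg.2 (htsq t ht)) _).trans (div_eq_mul_inv _ _)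
  have hint : IntervalIntegrable (fun t => Real.sqrt (s ^ 2 - t ^ 2) *
      (Real.sqrt ((1 - t ^ 2) * (1 - k ^ 2 * t ^ 2)))⁻¹) MeasureTheory.volume (-s) s := by
    refine ContinuousOn.intervalIntegrable ?_
    rw [Set.uIcc_of_le (by linarith)]
    refine ContinuousOn.mul (by fun_prop) (ContinuousOn.inv₀ (by fun_prop) fun t ht => ?_)
    have h1 := htsq t ht
    have h2 : k ^ 2 * t ^ 2 ≤ t ^ 2 := by nlinarith [sq_nonneg t]
    exact (Real.sqrt_pos.2 (mul_pos (by linarith) (by linarith))).ne'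
  have hmain := integral_sqrt_mul_even_quartic hs0 ((1 + k ^ 2) / 2)
    ((3 + 2 * k ^ 2 + 3 * (k ^ 2) ^ 2) / 8)
  have herr : ‖∫ t in (-s)..s, (Real.sqrt (s ^ 2 - t ^ 2) *
        (Real.sqrt ((1 - t ^ 2) * (1 - k ^ 2 * t ^ 2)))⁻¹ - Real.sqrt (s ^ 2 - t ^ 2) *
        (1 + (1 + k ^ 2) / 2 * t ^ 2 + (3 + 2 * k ^ 2 + 3 * (k ^ 2) ^ 2) / 8 * (t ^ 2) ^ 2))‖
      ≤ s * (C * (s ^ 2) ^ 3) * |s - -s| := by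
    refine intervalIntegral.norm_integral_le_of_norm_le_const fun t ht => ?_
    rw [Set.uIoc_of_le (by linarith)] at ht
    have h1 := htsq t ⟨ht.1.le, ht.2⟩
    rw [← mul_sub, Real.norm_eq_abs, abs_mul, abs_of_nonneg (Real.sqrt_nonneg _)]
    have h2 : Real.sqrt (s ^ 2 - t ^ 2) ≤ s := Real.sqrt_le_iff.2 ⟨hs0.le, by nlinarith⟩
    refine mul_le_mul h2 ((hbound (t ^ 2) (sq_nonneg t) (by linarith)).trans ?_)
      (abs_nonneg _) hs0.le
    gcongr
  rw [intervalIntegral.integral_sub hint (Continuous.intervalIntegrable (by fun_prop) _ _),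
    hmain, ← hfactor] at herr
  rw [hF s ⟨hs0, by linarith⟩]
  set I := ∫ t in (-s)..s, Real.sqrt ((s ^ 2 - t ^ 2) / ((1 - t ^ 2) * (1 - k ^ 2 * t ^ 2)))
  have heq : 2 / Real.pi * I - s ^ 2 - ((1 + k ^ 2) / 8) * s ^ 4
        - ((3 + 2 * k ^ 2 + 3 * k ^ 4) / 64) * s ^ 6 =
      2 / Real.pi * (I - Real.pi / 2 * (s ^ 2 + (1 + k ^ 2) / 2 / 4 * s ^ 4
        + (3 + 2 * k ^ 2 + 3 * (k ^ 2) ^ 2) / 8 / 8 * s ^ 6)) := by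
    field_simp
    ring
  rw [heq, norm_mul, Real.norm_of_nonneg (by positivity : 0 ≤ 2 / Real.pi),
    Real.norm_of_nonneg (by positivity : 0 ≤ s ^ 8), mul_assoc]
  refine mul_le_mul_of_nonneg_left (herr.trans_eq ?_) (by positivity)
  rw [abs_of_pos (by linarith)]
  ring
end

section
/- Let k be a real number with 0 < k < 1 and set ζ_* = √(2·arctanh(k)/k). For t ∈ (0, ζ_*] define X(t) = sinh(kt²)/k − (1 + 1/k²)·sinh(kt²/2)² (so that 0 < X(t) ≤ 1), ψ(t) = 3/(4t²) + (t²/4) · ( k²(X(t) + X(t)²) + X(t) − 3 ) / X(t)² + (1 + k²)/8, and C(t) = 2k·coth(kt²/2) − k² − 1. Then for every ζ ∈ (0, ζ_*], 16 · ∫_0^ζ ψ(t)/t dt = (k² + 1)·ln( ζ²·C(ζ)/4 ) − 3(k² − 1)²/(2·C(ζ)) + 3k·coth(kζ²/2) + 2k²ζ² − 6/ζ². -/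
/-- The inverse hyperbolic tangent. -/
noncomputable def arctanh (x : ℝ) : ℝ := (1 / 2) * Real.log ((1 + x) / (1 - x))

/-- The hyperbolic cotangent. -/
noncomputable def coth (x : ℝ) : ℝ := Real.cosh x / Real.sinh x

open Set Filter Topology MeasureTheory

theorem hasDerivAt_coth {x : ℝ} (hx : x ≠ 0) : HasDerivAt coth (1 - coth x ^ 2) x := by
  have hs : Real.sinh x ≠ 0 := Real.sinh_ne_zero.2 hx
  refine ((Real.hasDerivAt_cosh x).fun_div (Real.hasDerivAt_sinh x) hs).congr_deriv ?_
  unfold coth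
  field_simp

theorem inv_le_coth {x : ℝ} (hx : 0 < x) : 1 / x ≤ coth x := by
  have hmono : MonotoneOn (fun y : ℝ => y * Real.cosh y - Real.sinh y) (Ici 0) := by
    refine monotoneOn_of_hasDerivWithinAt_nonneg (f' := fun y => y * Real.sinh y) (convex_Ici 0)
      (by fun_prop) (fun y _ => ?_) (fun y hy => ?_)
    · refine HasDerivAt.hasDerivWithinAt ?_
      refine (((hasDerivAt_id' y).fun_mul (Real.hasDerivAt_cosh y)).fun_sub
        (Real.hasDerivAt_sinh y)).congr_deriv ?_
      ring
    · rw [interior_Ici] at hy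
      exact mul_nonneg hy.le (Real.sinh_nonneg_iff.2 hy.le)
  have h := hmono self_mem_Ici (mem_Ici.2 hx.le) hx.le
  simp only [zero_mul, Real.sinh_zero, sub_zero] at h
  rw [coth, div_le_div_iff₀ hx (Real.sinh_pos_iff.2 hx)]
  linarith

theorem coth_le_inv_add {x : ℝ} (hx : 0 < x) : coth x ≤ 1 / x + x := by
  have hmono : MonotoneOn
      (fun y : ℝ => (y ^ 2 + 1) * Real.sinh y - y * Real.cosh y) (Ici 0) := by
    refine monotoneOn_of_hasDerivWithinAt_nonneg
      (f' := fun y => y * Real.sinh y + y ^ 2 * Real.cosh y) (convex_Ici 0)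
      (by fun_prop) (fun y _ => ?_) (fun y hy => ?_)
    · refine HasDerivAt.hasDerivWithinAt ?_
      refine ((((hasDerivAt_pow 2 y).add_const 1).fun_mul (Real.hasDerivAt_sinh y)).fun_sub
        ((hasDerivAt_id' y).fun_mul (Real.hasDerivAt_cosh y))).congr_deriv ?_
      simp
      ring
    · rw [interior_Ici] at hy
      have := Real.sinh_nonneg_iff.2 (le_of_lt hy)
      have := Real.cosh_pos y
      have : 0 < y := hy
      positivity
  have h := hmono self_mem_Ici (mem_Ici.2 hx.le) hx.le
  simp only [zero_mul, Real.sinh_zero, mul_zero, sub_zero] at h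
  rw [coth, div_add' _ _ _ hx.ne', div_le_div_iff₀ (Real.sinh_pos_iff.2 hx) hx]
  nlinarith

/-- The function `C` as an explicit expression. -/
noncomputable def lameC (k t : ℝ) : ℝ := 2 * k * coth (k * t ^ 2 / 2) - k ^ 2 - 1

/-- The reciprocal of `X`, as a rational function of `C`. -/
noncomputable def lameY (k t : ℝ) : ℝ :=
  lameC k t / 4 + (1 + k ^ 2) / 2 + (k ^ 2 - 1) ^ 2 / (4 * lameC k t)

/-- The limiting error-control function divided by `t`, in terms of `1 / X`. -/
noncomputable def lameIntegrand (k t : ℝ) : ℝ :=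
  (3 / (4 * t ^ 2) + t ^ 2 / 4 * (k ^ 2 + (1 + k ^ 2) * lameY k t - 3 * lameY k t ^ 2)
    + (1 + k ^ 2) / 8) / t

/-- The closed form of `16 ∫₀^t ψ(u)/u du`. -/
noncomputable def lamePrimitive (k t : ℝ) : ℝ :=
  (k ^ 2 + 1) * Real.log (t ^ 2 * lameC k t / 4) - 3 * (k ^ 2 - 1) ^ 2 / (2 * lameC k t)
    + 3 * k * coth (k * t ^ 2 / 2) + 2 * k ^ 2 * t ^ 2 - 6 / t ^ 2

theorem sinh_sq_mul_lameC {k t : ℝ} (hk : 0 < k) (ht : 0 < t) :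
    Real.sinh (k * t ^ 2) / k - (1 + 1 / k ^ 2) * Real.sinh (k * t ^ 2 / 2) ^ 2
      = Real.sinh (k * t ^ 2 / 2) ^ 2 * lameC k t / k ^ 2 := by
  have hs : Real.sinh (k * t ^ 2 / 2) ≠ 0 := Real.sinh_ne_zero.2 (by positivity)
  have h2 : Real.sinh (k * t ^ 2) =
      2 * Real.sinh (k * t ^ 2 / 2) * Real.cosh (k * t ^ 2 / 2) := by
    rw [← Real.sinh_two_mul]
    ring_nf
  rw [h2, lameC, coth]
  field_simp
  ring

theorem one_div_eq_lameY {k t : ℝ} (hk : 0 < k) (ht : 0 < t) (hC : lameC k t ≠ 0) :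
    1 / (Real.sinh (k * t ^ 2 / 2) ^ 2 * lameC k t / k ^ 2) = lameY k t := by
  have hs : Real.sinh (k * t ^ 2 / 2) ≠ 0 := Real.sinh_ne_zero.2 (by positivity)
  have hc : Real.sinh (k * t ^ 2 / 2) ^ 2 * ((lameC k t + k ^ 2 + 1) ^ 2 - 4 * k ^ 2)
      = 4 * k ^ 2 := by
    have h : lameC k t + k ^ 2 + 1 = 2 * k * coth (k * t ^ 2 / 2) := by rw [lameC]; ring
    rw [h, coth]
    field_simp
    rw [Real.cosh_sq]
    ring
  rw [lameY]
  field_simp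
  linear_combination -2 * hc

theorem hasDerivAt_lameC {k t : ℝ} (hk : 0 < k) (ht : 0 < t) (hC : lameC k t ≠ 0) :
    HasDerivAt (lameC k) (-2 * t * lameC k t * lameY k t) t := by
  have ha : HasDerivAt (fun u : ℝ => k * u ^ 2 / 2) (k * t) t := by
    refine (((hasDerivAt_pow 2 t).const_mul k).div_const 2).congr_deriv ?_
    simp
    ring
  have hcoth : HasDerivAt coth _ (k * t ^ 2 / 2) := hasDerivAt_coth (by positivity)
  refine ((((hcoth.comp t ha).const_mul (2 * k)).sub_const (k ^ 2)).sub_const 1).congr_deriv ?_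
  have h : coth (k * t ^ 2 / 2) = (lameC k t + k ^ 2 + 1) / (2 * k) := by
    rw [lameC]; field_simp; ring
  rw [h, lameY]
  field_simp
  ring

theorem hasDerivAt_lamePrimitive {k t : ℝ} (hk : 0 < k) (ht : 0 < t) (hC : 0 < lameC k t) :
    HasDerivAt (lamePrimitive k) (16 * lameIntegrand k t) t := by
  have hd := hasDerivAt_lameC hk ht hC.ne'
  have hsq : HasDerivAt (fun u : ℝ => u ^ 2) (2 * t) t := by
    simpa using hasDerivAt_pow 2 t
  have hlog := (((hsq.fun_mul hd).div_const 4).log (by positivity)).const_mul (k ^ 2 + 1)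
  have hinv := (hasDerivAt_const t (3 * (k ^ 2 - 1) ^ 2)).fun_div (hd.const_mul 2) (by positivity)
  have hcoth := ((hd.add_const (k ^ 2 + 1)).const_mul (3 / 2 : ℝ))
  have hpow := hsq.const_mul (2 * k ^ 2)
  have hsix := (hasDerivAt_const t (6 : ℝ)).fun_div hsq (by positivity)
  have hfun : lamePrimitive k = fun u =>
      (k ^ 2 + 1) * Real.log (u ^ 2 * lameC k u / 4) - 3 * (k ^ 2 - 1) ^ 2 / (2 * lameC k u)
        + 3 / 2 * (lameC k u + (k ^ 2 + 1)) + 2 * k ^ 2 * u ^ 2 - 6 / u ^ 2 := by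
    funext u
    rw [lamePrimitive, lameC]
    ring
  rw [hfun]
  refine ((((hlog.fun_sub hinv).fun_add hcoth).fun_add hpow).fun_sub hsix).congr_deriv ?_
  have hC' := hC.ne'
  rw [lameIntegrand, lameY]
  field_simp
  ring

/-- Two-sided bounds for `C` near zero, following from `1 / a ≤ coth a ≤ 1 / a + a`. -/
theorem lameC_bounds {k t : ℝ} (hk : 0 < k) (ht : 0 < t) :
    4 / t ^ 2 - (1 + k ^ 2) ≤ lameC k t ∧
      lameC k t ≤ 4 / t ^ 2 - (1 + k ^ 2) + k ^ 2 * t ^ 2 := by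
  have ha : 0 < k * t ^ 2 / 2 := by positivity
  have h1 := mul_le_mul_of_nonneg_left (inv_le_coth ha) (by positivity : 0 ≤ 2 * k)
  have h2 := mul_le_mul_of_nonneg_left (coth_le_inv_add ha) (by positivity : 0 ≤ 2 * k)
  have h3 : 2 * k * (1 / (k * t ^ 2 / 2)) = 4 / t ^ 2 := by field_simp; norm_num
  rw [mul_add, h3] at h2
  rw [h3] at h1
  unfold lameC
  constructor <;> nlinarith

theorem abs_lameIntegrand_le {k t : ℝ} (hk : 0 < k) (hk1 : k < 1) (ht : 0 < t) (ht1 : t ≤ 1) :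
    |lameIntegrand k t| ≤ 5 := by
  obtain ⟨hl, hu⟩ := lameC_bounds hk ht
  set r := lameC k t - (4 / t ^ 2 - (1 + k ^ 2)) with hr
  have hr0 : 0 ≤ r := by linarith
  have hr1 : r ≤ k ^ 2 * t ^ 2 := by linarith
  have hs0 : 0 < t ^ 2 := by positivity
  have hs1 : t ^ 2 ≤ 1 := pow_le_one₀ ht.le ht1
  have hk2 : k ^ 2 ≤ 1 := pow_le_one₀ hk.le hk1.le
  have hk20 : 0 < k ^ 2 := by positivity
  have hC : lameC k t = 4 / t ^ 2 - (1 + k ^ 2) + r := by rw [hr]; ring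
  set q := t ^ 2 * lameC k t / 4 with hq
  have hqe : q = 1 - (1 + k ^ 2) * t ^ 2 / 4 + t ^ 2 * r / 4 := by
    rw [hq, hC]; field_simp
  have hq2 : 1 / 2 ≤ q := by
    rw [hqe]; nlinarith [mul_nonneg hs0.le hr0]
  have hCq : lameC k t = 4 * q / t ^ 2 := by rw [hq]; field_simp
  have hY0 : lameC k t ≠ 0 := by rw [hCq]; positivity
  set v := (k ^ 2 - 1) ^ 2 / (16 * q) with hv
  have hv0 : 0 ≤ v := by positivity
  have hv1 : v ≤ 1 / 8 := by
    rw [hv, div_le_iff₀ (by positivity)]; nlinarith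
  set w := r / (4 * t ^ 2) + v with hw
  have hw0 : 0 ≤ w := by positivity
  have hw1 : w ≤ 1 / 2 := by
    have : r / (4 * t ^ 2) ≤ 1 / 4 := by
      rw [div_le_iff₀ (by positivity)]; nlinarith
    linarith
  have hY : lameY k t = (1 + (1 + k ^ 2) * t ^ 2 / 4 + t ^ 4 * w) / t ^ 2 := by
    have h1 : (k ^ 2 - 1) ^ 2 / (4 * lameC k t) = t ^ 2 * v := by
      rw [hv, hCq]; field_simp; norm_num
    rw [lameY, h1, hC, hw]
    field_simp
    ring
  have hN : lameIntegrand k t = t / 4 * (k ^ 2 + (1 + k ^ 2) ^ 2 / 16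
      - (1 + k ^ 2) * t ^ 2 * w / 2 - 6 * w - 3 * t ^ 4 * w ^ 2) := by
    rw [lameIntegrand, hY]
    field_simp
    ring
  have hm : (1 + k ^ 2) ^ 2 ≤ 4 := by nlinarith
  have hA : (1 + k ^ 2) * t ^ 2 * w ≤ 2 * 1 * (1 / 2) := by gcongr; linarith
  have hB : t ^ 4 * w ^ 2 ≤ 1 * (1 / 2) ^ 2 := by gcongr; exact pow_le_one₀ ht.le ht1
  have hA0 : 0 ≤ (1 + k ^ 2) * t ^ 2 * w := by positivity
  have hB0 : 0 ≤ t ^ 4 * w ^ 2 := by positivity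
  have hm0 : 0 ≤ (1 + k ^ 2) ^ 2 := by positivity
  rw [hN, abs_mul, abs_of_pos (by positivity : 0 < t / 4)]
  have : |k ^ 2 + (1 + k ^ 2) ^ 2 / 16
      - (1 + k ^ 2) * t ^ 2 * w / 2 - 6 * w - 3 * t ^ 4 * w ^ 2| ≤ 20 :=
    abs_le.2 ⟨by linarith, by linarith⟩
  calc t / 4 * _ ≤ 1 / 4 * 20 := by gcongr
    _ = 5 := by norm_num

theorem tendsto_lamePrimitive {k : ℝ} (hk : 0 < k) :
    Tendsto (lamePrimitive k) (𝓝[>] 0) (𝓝 0) := by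
  have hsq : Tendsto (fun t : ℝ => t ^ 2) (𝓝[>] 0) (𝓝 0) := by
    have : Tendsto (fun t : ℝ => t ^ 2) (𝓝 0) (𝓝 (0 ^ 2)) := (continuous_pow 2).tendsto 0
    rw [zero_pow two_ne_zero] at this
    exact this.mono_left nhdsWithin_le_nhds
  have hr : Tendsto (fun t => lameC k t - (4 / t ^ 2 - (1 + k ^ 2))) (𝓝[>] 0) (𝓝 0) := by
    refine tendsto_of_tendsto_of_tendsto_of_le_of_le' tendsto_const_nhds
      (by simpa using hsq.const_mul (k ^ 2)) ?_ ?_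
    · filter_upwards [self_mem_nhdsWithin] with t ht
      linarith [(lameC_bounds hk ht).1]
    · filter_upwards [self_mem_nhdsWithin] with t ht
      linarith [(lameC_bounds hk ht).2]
  have hq : Tendsto (fun t => t ^ 2 * lameC k t / 4) (𝓝[>] 0) (𝓝 1) := by
    have h := ((hsq.mul ((hr.sub_const (1 + k ^ 2)))).div_const 4).const_add 1
    simp only [zero_mul, zero_div, add_zero] at h
    refine h.congr' ?_
    filter_upwards [self_mem_nhdsWithin] with t ht
    have : t ≠ 0 := ne_of_gt ht
    field_simp
    ring
  have hlog := (hq.log one_ne_zero).const_mul (k ^ 2 + 1)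
  have hinv := ((hsq.div hq one_ne_zero).const_mul (3 * (k ^ 2 - 1) ^ 2 / 8))
  have h := ((hlog.sub hinv).add (hr.const_mul (3 / 2))).add (hsq.const_mul (2 * k ^ 2))
  simp only [Real.log_one, mul_zero, zero_div, sub_zero, add_zero] at h
  refine h.congr' ?_
  filter_upwards [self_mem_nhdsWithin] with t ht
  have ht' : t ≠ 0 := ne_of_gt ht
  have h1 : t ^ 2 / (t ^ 2 * lameC k t / 4) = 4 / lameC k t := by
    rw [div_div_eq_mul_div, mul_div_mul_left _ _ (pow_ne_zero 2 ht')]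
  simp only [Pi.div_apply]
  rw [h1, lamePrimitive]
  have h2 : 3 * k * coth (k * t ^ 2 / 2) = 3 / 2 * (lameC k t + (1 + k ^ 2)) := by
    rw [lameC]; ring
  rw [h2]
  ring

theorem continuousOn_lameIntegrand {k : ℝ} (hk : 0 < k) {s : Set ℝ}
    (hs : ∀ t ∈ s, 0 < t ∧ 0 < lameC k t) : ContinuousOn (lameIntegrand k) s := by
  intro t ht
  obtain ⟨h0, hC⟩ := hs t ht
  have hc : ContinuousAt (lameC k) t := (hasDerivAt_lameC hk h0 hC.ne').continuousAt
  have hY : ContinuousAt (lameY k) t := by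
    unfold lameY
    fun_prop (disch := positivity)
  refine ContinuousAt.continuousWithinAt ?_
  unfold lameIntegrand
  fun_prop (disch := positivity)

theorem intervalIntegrable_lameIntegrand {k b : ℝ} (hk : 0 < k) (hk1 : k < 1) (hb : 0 < b)
    (hC : ∀ t ∈ Ioc 0 b, 0 < lameC k t) : IntervalIntegrable (lameIntegrand k) volume 0 b := by
  have hc := continuousOn_lameIntegrand hk (fun t ht => ⟨ht.1, hC t ht⟩)
  have hd : 0 < min b 1 := lt_min hb one_pos
  refine IntervalIntegrable.trans (b := min b 1) ?_ ?_
  · rw [intervalIntegrable_iff_integrableOn_Ioc_of_le hd.le]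
    refine Integrable.of_bound ((hc.mono (Ioc_subset_Ioc_right
      (min_le_left b 1))).aestronglyMeasurable measurableSet_Ioc) 5 ?_
    filter_upwards [ae_restrict_mem measurableSet_Ioc] with t ht
    exact abs_lameIntegrand_le hk hk1 ht.1 (ht.2.trans (min_le_right b 1))
  · refine ContinuousOn.intervalIntegrable_of_Icc (min_le_left b 1) (hc.mono fun t ht => ?_)
    exact ⟨hd.trans_le ht.1, ht.2⟩

/-- Closed-form evaluation of `16∫₀^ζ ψ(t)/t dt` for the limiting error-control
function `ψ` of the Lamé equation. -/
theorem stmt6 (k : ℝ) (hk : 0 < k) (hk1 : k < 1)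
    (ζstar : ℝ) (hζstar : ζstar = Real.sqrt (2 * arctanh k / k))
    (X ψ C : ℝ → ℝ)
    (hX : ∀ t ∈ Set.Ioc (0:ℝ) ζstar,
      X t = Real.sinh (k * t ^ 2) / k - (1 + 1 / k ^ 2) * Real.sinh (k * t ^ 2 / 2) ^ 2)
    (hXpos : ∀ t ∈ Set.Ioc (0:ℝ) ζstar, 0 < X t ∧ X t ≤ 1)
    (hψ : ∀ t ∈ Set.Ioc (0:ℝ) ζstar,
      ψ t = 3 / (4 * t ^ 2)
        + (t ^ 2 / 4) * ((k ^ 2 * (X t + (X t) ^ 2) + X t - 3) / (X t) ^ 2)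
        + (1 + k ^ 2) / 8)
    (hC : ∀ t ∈ Set.Ioc (0:ℝ) ζstar, C t = 2 * k * coth (k * t ^ 2 / 2) - k ^ 2 - 1) :
    ∀ ζ ∈ Set.Ioc (0:ℝ) ζstar,
      16 * ∫ t in (0:ℝ)..ζ, ψ t / t =
        (k ^ 2 + 1) * Real.log (ζ ^ 2 * C ζ / 4) - 3 * (k ^ 2 - 1) ^ 2 / (2 * C ζ)
          + 3 * k * coth (k * ζ ^ 2 / 2) + 2 * k ^ 2 * ζ ^ 2 - 6 / ζ ^ 2 := by
  intro ζ hζ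
  have hXC : ∀ t ∈ Ioc 0 ζstar, X t = Real.sinh (k * t ^ 2 / 2) ^ 2 * lameC k t / k ^ 2 :=
    fun t ht => (hX t ht).trans (sinh_sq_mul_lameC hk ht.1)
  have hCpos : ∀ t ∈ Ioc 0 ζstar, 0 < lameC k t := by
    intro t ht
    have h := (hXpos t ht).1
    rw [hXC t ht, mul_div_right_comm] at h
    exact pos_of_mul_pos_right h (by positivity)
  have hψ' : ∀ t ∈ Ioc 0 ζstar, ψ t / t = lameIntegrand k t := by
    intro t ht
    have hX0 := (hXpos t ht).1.ne'
    rw [hψ t ht, lameIntegrand, ← one_div_eq_lameY hk ht.1 (hCpos t ht).ne', ← hXC t ht]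
    congr 3
    field_simp
    ring
  have hsub : Ioc 0 ζ ⊆ Ioc 0 ζstar := Ioc_subset_Ioc_right hζ.2
  have hcongr : ∫ t in (0:ℝ)..ζ, ψ t / t = ∫ t in (0:ℝ)..ζ, lameIntegrand k t := by
    refine intervalIntegral.integral_congr_ae (ae_of_all _ fun t ht => ?_)
    rw [uIoc_of_le hζ.1.le] at ht
    exact hψ' t (hsub ht)
  have hint := intervalIntegrable_lameIntegrand hk hk1 hζ.1 fun t ht => hCpos t (hsub ht)
  have hFTC := intervalIntegral.integral_eq_sub_of_hasDerivAt_of_tendsto hζ.1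
    (fun t ht => hasDerivAt_lamePrimitive hk ht.1 (hCpos t (hsub (Ioo_subset_Ioc_self ht))))
    (hint.const_mul 16) (tendsto_lamePrimitive hk)
    ((hasDerivAt_lamePrimitive hk hζ.1 (hCpos ζ hζ)).continuousAt.tendsto.mono_left
      nhdsWithin_le_nhds)
  rw [hcongr, ← intervalIntegral.integral_const_mul, hFTC, sub_zero, hC ζ hζ]
  rfl
end

section
/- For t ∈ (0, √2] define X(t) = t²(1 − t²/4) and ψ(t) = 3/(4t²) + (t²/4)·(X(t) − 3)/X(t)² + 1/8. Then for every ζ ∈ (0, √2], 32 · ∫_0^ζ ψ(t)/t dt = 2·ln(1 − ζ²/4) − 3ζ²/(4 − ζ²). -/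
theorem hasDerivAt_log_sub_div {t : ℝ} (ht : 0 < 4 - t ^ 2) :
    HasDerivAt (fun t : ℝ => 2 * Real.log (1 - t ^ 2 / 4) - 3 * t ^ 2 / (4 - t ^ 2))
      (32 * (-t * (10 - t ^ 2) / (8 * (4 - t ^ 2) ^ 2))) t := by
  have hlog : 1 - t ^ 2 / 4 ≠ 0 := by linarith
  have hsq := hasDerivAt_pow 2 t
  refine ((((hsq.div_const 4).const_sub 1).log hlog).const_mul 2 |>.sub
    ((hsq.const_mul 3).div (hsq.const_sub 4) ht.ne')).congr_deriv ?_
  have h : 1 - t ^ 2 / 4 = (4 - t ^ 2) / 4 := by ring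
  rw [h]
  have hne := ht.ne'
  field_simp
  ring


/-- Mathieu limiting case: with `X(t) = t²(1 - t²/4)` and
`ψ(t) = 3/(4t²) + (t²/4)(X(t)-3)/X(t)² + 1/8`, for `ζ ∈ (0, √2]` we have
`32 ∫₀^ζ ψ(t)/t dt = 2 ln(1 - ζ²/4) - 3ζ²/(4 - ζ²)`. -/
theorem stmt7 (X ψ : ℝ → ℝ)
    (hX : ∀ t ∈ Set.Ioc (0:ℝ) (Real.sqrt 2), X t = t ^ 2 * (1 - t ^ 2 / 4))
    (hψ : ∀ t ∈ Set.Ioc (0:ℝ) (Real.sqrt 2),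
      ψ t = 3 / (4 * t ^ 2) + (t ^ 2 / 4) * ((X t - 3) / (X t) ^ 2) + 1 / 8) :
    ∀ ζ ∈ Set.Ioc (0:ℝ) (Real.sqrt 2),
      32 * ∫ t in (0:ℝ)..ζ, ψ t / t =
        2 * Real.log (1 - ζ ^ 2 / 4) - 3 * ζ ^ 2 / (4 - ζ ^ 2) := by
  intro ζ hζ
  have hsqrt : Real.sqrt 2 ^ 2 = 2 := Real.sq_sqrt (by norm_num)
  have hpos : ∀ t ∈ Set.uIcc (0:ℝ) ζ, 0 < 4 - t ^ 2 := by
    intro t ht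
    rw [Set.uIcc_of_le hζ.1.le] at ht
    have := pow_le_pow_left₀ ht.1 (ht.2.trans hζ.2) 2
    linarith
  have hcongr : ∫ t in (0:ℝ)..ζ, ψ t / t =
      ∫ t in (0:ℝ)..ζ, -t * (10 - t ^ 2) / (8 * (4 - t ^ 2) ^ 2) := by
    refine intervalIntegral.integral_congr_uIoo fun t ht => ?_
    rw [Set.uIoo_of_le hζ.1.le] at ht
    have ht' : t ∈ Set.Ioc (0:ℝ) (Real.sqrt 2) := ⟨ht.1, ht.2.le.trans hζ.2⟩
    have hne : t ≠ 0 := ht.1.ne'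
    have hu : 4 - t ^ 2 ≠ 0 :=
      (hpos t (by rw [Set.uIcc_of_le hζ.1.le]; exact ⟨ht.1.le, ht.2.le⟩)).ne'
    have hXt : X t = t ^ 2 * (4 - t ^ 2) / 4 := by rw [hX t ht']; ring
    simp only [hψ t ht', hXt]
    field_simp
    ring
  rw [hcongr, ← intervalIntegral.integral_const_mul,
    intervalIntegral.integral_eq_sub_of_hasDerivAt fun t ht => hasDerivAt_log_sub_div (hpos t ht)]
  · norm_num
  · refine ContinuousOn.intervalIntegrable ?_
    refine continuousOn_const.mul (ContinuousOn.div (by fun_prop) (by fun_prop) fun t ht => ?_)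
    have := hpos t ht
    positivity
end

section
/- Let f, g : ℝ → ℝ be twice differentiable functions. Then at every point of ℝ, the 3×3 Wronskian determinant of the triple (f², g², f·g) — the determinant of the matrix whose rows are (f², g², fg), their first derivatives, and their second derivatives — equals −2·(f·g' − f'·g)³. -/
theorem deriv_fun_mul_of_differentiable {u v : ℝ → ℝ} (hu : Differentiable ℝ u)
    (hv : Differentiable ℝ v) :
    deriv (fun y => u y * v y) = fun y => deriv u y * v y + u y * deriv v y :=
  funext fun y => ((hu y).hasDerivAt.mul (hv y).hasDerivAt).deriv

theorem deriv_deriv_fun_mul_of_differentiable {u v : ℝ → ℝ} (hu : Differentiable ℝ u)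
    (hu' : Differentiable ℝ (deriv u)) (hv : Differentiable ℝ v)
    (hv' : Differentiable ℝ (deriv v)) (x : ℝ) :
    deriv (deriv (fun y => u y * v y)) x =
      deriv (deriv u) x * v x + deriv u x * deriv v x +
        (deriv u x * deriv v x + u x * deriv (deriv v) x) := by
  rw [deriv_fun_mul_of_differentiable hu hv]
  exact (((hu' x).hasDerivAt.mul (hv x).hasDerivAt).add
    ((hu x).hasDerivAt.mul (hv' x).hasDerivAt)).deriv

/-- The 3×3 Wronskian of `(f², g², fg)` equals `-2 (f g' - f' g)³`. -/
theorem stmt8 (f g : ℝ → ℝ)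
    (hf : Differentiable ℝ f) (hf' : Differentiable ℝ (deriv f))
    (hg : Differentiable ℝ g) (hg' : Differentiable ℝ (deriv g)) :
    ∀ x : ℝ,
      Matrix.det
        !![f x ^ 2, g x ^ 2, f x * g x;
           deriv (fun y => f y ^ 2) x, deriv (fun y => g y ^ 2) x,
             deriv (fun y => f y * g y) x;
           deriv (deriv (fun y => f y ^ 2)) x, deriv (deriv (fun y => g y ^ 2)) x,
             deriv (deriv (fun y => f y * g y)) x]
      = -2 * (f x * deriv g x - deriv f x * g x) ^ 3 := by
  intro x
  simp only [pow_two (f _), pow_two (g _),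
    deriv_deriv_fun_mul_of_differentiable hf hf' hf hf',
    deriv_deriv_fun_mul_of_differentiable hg hg' hg hg',
    deriv_deriv_fun_mul_of_differentiable hf hf' hg hg']
  simp only [deriv_fun_mul_of_differentiable hf hf, deriv_fun_mul_of_differentiable hg hg,
    deriv_fun_mul_of_differentiable hf hg]
  rw [Matrix.det_fin_three]
  simp only [Matrix.of_apply, Matrix.cons_val]
  ring
end

section
/- For natural numbers m and n with n ≥ 4, define p(m, j) = ∫_ℝ t^j · e^{−t²/2} · He_m(t)² dt. Then n · p(m, n) = 2(n − 1)(2m + 1) · p(m, n − 2) + (n − 1)(n − 2)(n − 3) · p(m, n − 4). -/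
/-- The `m`-th probabilists' Hermite polynomial, as a real function. -/
noncomputable def He (m : ℕ) (t : ℝ) : ℝ := Polynomial.aeval t (Polynomial.hermite m)

/-- The Hermite differential equation `Hₘ'' = X Hₘ' - m Hₘ`. -/
theorem derivative_derivative_hermite (m : ℕ) :
    Polynomial.derivative (Polynomial.derivative (Polynomial.hermite m)) =
      Polynomial.X * Polynomial.derivative (Polynomial.hermite m)
        - (m : Polynomial ℤ) * Polynomial.hermite m := by
  induction m with
  | zero => simp
  | succ m ih =>
    have h : Polynomial.derivative (Polynomial.hermite (m + 1)) =
        ((m : Polynomial ℤ) + 1) * Polynomial.hermite m := by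
      rw [Polynomial.hermite_succ, Polynomial.derivative_sub, Polynomial.derivative_mul, ih,
        Polynomial.derivative_X]
      ring
    rw [h, Polynomial.hermite_succ]
    simp only [Polynomial.derivative_mul, Polynomial.derivative_add, Polynomial.derivative_natCast,
      Polynomial.derivative_one]
    push_cast
    ring

theorem integrable_eval_mul_exp_neg_sq_div_two (P : Polynomial ℝ) :
    MeasureTheory.Integrable (fun t : ℝ => P.eval t * Real.exp (-t ^ 2 / 2)) := by
  induction P using Polynomial.induction_on' with
  | add p q hp hq =>
    refine (hp.add hq).congr (Filter.Eventually.of_forall fun t => ?_)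
    simp only [Pi.add_apply, Polynomial.eval_add, add_mul]
  | monomial n a =>
    have h := integrable_rpow_mul_exp_neg_mul_sq (b := 1 / 2) (by norm_num) (s := n)
      (by linarith [n.cast_nonneg (α := ℝ)])
    refine (h.const_mul a).congr (Filter.Eventually.of_forall fun t => ?_)
    simp only [Polynomial.eval_monomial, Real.rpow_natCast]
    rw [show -t ^ 2 / 2 = -(1 / 2) * t ^ 2 by ring]
    ring

/-- Integration by parts against the Gaussian weight. -/
theorem integral_eval_derivative_sub_X_mul (P : Polynomial ℝ) :
    ∫ t : ℝ, (Polynomial.derivative P - Polynomial.X * P).eval t * Real.exp (-t ^ 2 / 2) = 0 := by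
  refine MeasureTheory.integral_eq_zero_of_hasDerivAt_of_integrable
    (f := fun t : ℝ => P.eval t * Real.exp (-t ^ 2 / 2)) (fun t => ?_)
    (integrable_eval_mul_exp_neg_sq_div_two _) (integrable_eval_mul_exp_neg_sq_div_two _)
  have h : HasDerivAt (fun t : ℝ => -t ^ 2 / 2) (-t) t := by
    refine ((hasDerivAt_pow 2 t).neg.div_const 2).congr_deriv ?_
    norm_num
    ring
  refine ((P.hasDerivAt t).mul h.exp).congr_deriv ?_
  simp only [Polynomial.eval_sub, Polynomial.eval_mul, Polynomial.eval_X]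
  ring

/-- If `H'' = X H' - m H`, the moments of `H²` against the Gaussian weight come from an exact
derivative. -/
theorem exists_derivative_sub_X_mul_eq_moment (H : Polynomial ℝ) (m k : ℕ)
    (hH : Polynomial.derivative (Polynomial.derivative H) =
      Polynomial.X * Polynomial.derivative H - (m : Polynomial ℝ) * H) :
    ∃ P : Polynomial ℝ, Polynomial.derivative P - Polynomial.X * P =
      (-((k : Polynomial ℝ) + 4) * Polynomial.X ^ (k + 4)
        + 2 * ((k : Polynomial ℝ) + 3) * (2 * (m : Polynomial ℝ) + 1) * Polynomial.X ^ (k + 2)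
        + ((k : Polynomial ℝ) + 3) * ((k : Polynomial ℝ) + 2) * ((k : Polynomial ℝ) + 1)
          * Polynomial.X ^ k) * H ^ 2 := by
  refine ⟨Polynomial.X ^ (k + 3) * (2 * Polynomial.derivative H ^ 2
      - 2 * Polynomial.X * H * Polynomial.derivative H
      + (2 * (m : Polynomial ℝ) + 1) * H ^ 2)
    - ((k : Polynomial ℝ) + 3) * Polynomial.X ^ (k + 2)
      * (2 * H * Polynomial.derivative H - Polynomial.X * H ^ 2)
    + ((k : Polynomial ℝ) + 3) * ((k : Polynomial ℝ) + 2) * Polynomial.X ^ (k + 1) * H ^ 2, ?_⟩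
  simp only [Polynomial.derivative_mul, Polynomial.derivative_add, Polynomial.derivative_sub,
    Polynomial.derivative_natCast, Polynomial.derivative_one, Polynomial.derivative_ofNat,
    Polynomial.derivative_X, Polynomial.derivative_pow, hH,
    Nat.add_sub_cancel, show k + 3 - 1 = k + 2 from rfl, show k + 2 - 1 = k + 1 from rfl,
    map_natCast]
  push_cast
  ring

/-- Recurrence for the moments `p(m,j) = ∫ℝ tʲ e^{-t²/2} Heₘ(t)² dt`:
`n p(m,n) = 2(n-1)(2m+1) p(m,n-2) + (n-1)(n-2)(n-3) p(m,n-4)` for `n ≥ 4`. -/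
theorem stmt12 (m n : ℕ) (hn : 4 ≤ n) (p : ℕ → ℕ → ℝ)
    (hp : ∀ m' j : ℕ, p m' j = ∫ t : ℝ, t ^ j * Real.exp (-t ^ 2 / 2) * (He m' t) ^ 2) :
    (n : ℝ) * p m n =
      2 * ((n : ℝ) - 1) * (2 * (m : ℝ) + 1) * p m (n - 2)
        + ((n : ℝ) - 1) * ((n : ℝ) - 2) * ((n : ℝ) - 3) * p m (n - 4) := by
  obtain ⟨k, rfl⟩ := Nat.exists_eq_add_of_le' hn
  set H : Polynomial ℝ := (Polynomial.hermite m).map (Int.castRingHom ℝ) with hHdef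
  have hHe (t : ℝ) : He m t = H.eval t := by
    rw [He, hHdef, Polynomial.eval_map, Polynomial.aeval_def]
    rfl
  have hH : Polynomial.derivative (Polynomial.derivative H) =
      Polynomial.X * Polynomial.derivative H - (m : Polynomial ℝ) * H := by
    simpa [hHdef, Polynomial.derivative_map] using congrArg
      (Polynomial.map (Int.castRingHom ℝ)) (derivative_derivative_hermite m)
  have hint (j : ℕ) : MeasureTheory.Integrable
      (fun t : ℝ => t ^ j * Real.exp (-t ^ 2 / 2) * (He m t) ^ 2) := by
    refine (integrable_eval_mul_exp_neg_sq_div_two (Polynomial.X ^ j * H ^ 2)).congr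
      (Filter.Eventually.of_forall fun t => ?_)
    simp only [Polynomial.eval_mul, Polynomial.eval_pow, Polynomial.eval_X, hHe]
    ring
  obtain ⟨P, hP⟩ := exists_derivative_sub_X_mul_eq_moment H m k hH
  have h0 : -((k : ℝ) + 4) * p m (k + 4)
      + 2 * ((k : ℝ) + 3) * (2 * (m : ℝ) + 1) * p m (k + 2)
      + ((k : ℝ) + 3) * ((k : ℝ) + 2) * ((k : ℝ) + 1) * p m k = 0 := by
    rw [← integral_eval_derivative_sub_X_mul P, hP, hp, hp, hp,
      ← MeasureTheory.integral_const_mul, ← MeasureTheory.integral_const_mul,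
      ← MeasureTheory.integral_const_mul,
      ← MeasureTheory.integral_add ((hint _).const_mul _) ((hint _).const_mul _),
      ← MeasureTheory.integral_add
        (MeasureTheory.Integrable.fun_add ((hint _).const_mul _) ((hint _).const_mul _))
        ((hint _).const_mul _)]
    congr 1 with t
    simp only [Polynomial.eval_mul, Polynomial.eval_add, Polynomial.eval_neg, Polynomial.eval_pow,
      Polynomial.eval_X, Polynomial.eval_natCast, Polynomial.eval_ofNat, Polynomial.eval_one, hHe]
    ring
  rw [show k + 4 - 2 = k + 2 from rfl, Nat.add_sub_cancel]
  push_cast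
  linear_combination -h0
end
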